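/- Let (X,d) be a metric space, let (x₁,y₁),…,(x_m,y_m) be labeled points of X with labels y_j ∈ {−1,1}, and for each weight vector w ∈ (0,∞)^m define the classifier h_w : X → {−1,1} by h_w(z) = y_j, where j minimizes d(z,x_j)/w_j over j ∈ {1,…,m}, ties broken toward the smallest index. Then for every finite set Z ⊆ X with |Z| = N, the number of distinct restrictions of h_w to Z, over all w ∈ (0,∞)^m, is at most m!·(N+m)^m. -/

import Mathlib

/-- `j` is the smallest index minimizing the weighted cost `c j / w j`. -/
def IsLeastMinimizer {m : ℕ} (c w : Fin m → ℝ) (j : Fin m) : Prop :=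
  (∀ k, c j / w j ≤ c k / w k) ∧ ∀ k, c k / w k = c j / w j → j ≤ k

namespace IsLeastMinimizer

variable {m : ℕ} {c w w' : Fin m → ℝ} {i j : Fin m}

/-- A least minimizer of zero cost does not depend on the weights. -/
theorem eq_of_cost_eq_zero (hc : ∀ k, 0 ≤ c k) (hw' : ∀ k, 0 < w' k)
    (hi : IsLeastMinimizer c w i) (hj : IsLeastMinimizer c w' j) (h0 : c i = 0) : i = j := by
  have hj0 : c j = 0 := by
    have h := hj.1 i
    rw [h0, zero_div, div_le_iff₀ (hw' j), zero_mul] at h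
    exact le_antisymm h (hc j)
  exact le_antisymm (hi.2 j (by simp [h0, hj0])) (hj.2 i (by simp [h0, hj0]))

theorem log_sub_le (hw : ∀ k, 0 < w k) (hi : IsLeastMinimizer c w i) (hi0 : 0 < c i)
    (hj0 : 0 < c j) :
    Real.log (c i) - Real.log (w i) ≤ Real.log (c j) - Real.log (w j) := by
  rw [← Real.log_div hi0.ne' (hw i).ne', ← Real.log_div hj0.ne' (hw j).ne']
  exact Real.log_le_log (div_pos hi0 (hw i)) (hi.1 j)

theorem le_of_log_sub_eq (hw : ∀ k, 0 < w k) (hi : IsLeastMinimizer c w i) (hi0 : 0 < c i)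
    (hj0 : 0 < c j)
    (h : Real.log (c i) - Real.log (w i) = Real.log (c j) - Real.log (w j)) : i ≤ j := by
  rw [← Real.log_div hi0.ne' (hw i).ne', ← Real.log_div hj0.ne' (hw j).ne'] at h
  exact hi.2 j (Real.log_injOn_pos (div_pos hi0 (hw i)) (div_pos hj0 (hw j)) h).symm

end IsLeastMinimizer

theorem sum_comp_eq_of_card_fiber_eq {ι κ : Type*} [Fintype ι] [Fintype κ] [DecidableEq κ]
    {σ τ : ι → κ} (h : ∀ j, (Finset.univ.filter (σ · = j)).card =
      (Finset.univ.filter (τ · = j)).card) (u : κ → ℝ) :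
    ∑ z, u (σ z) = ∑ z, u (τ z) := by
  have key (ρ : ι → κ) :
      ∑ z, u (ρ z) = ∑ j, ((Finset.univ.filter (ρ · = j)).card : ℝ) * u j := by
    rw [← Finset.sum_fiberwise Finset.univ ρ]
    refine Finset.sum_congr rfl fun j _ => ?_
    rw [← nsmul_eq_mul, ← Finset.sum_const]
    exact Finset.sum_congr rfl fun z hz => by rw [(Finset.mem_filter.1 hz).2]
  simp only [key, h]

/-- Two assignments of points to weighted centers whose cells have the same sizes coincide:
both are optimal transport plans with the same marginals, so they agree up to ties. -/
theorem eq_of_card_fiber_eq {ι : Type*} [Fintype ι] {m : ℕ} {c : ι → Fin m → ℝ}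
    (hc : ∀ z k, 0 ≤ c z k) {w w' : Fin m → ℝ} (hw : ∀ k, 0 < w k) (hw' : ∀ k, 0 < w' k)
    {σ τ : ι → Fin m} (hσ : ∀ z, IsLeastMinimizer (c z) w (σ z))
    (hτ : ∀ z, IsLeastMinimizer (c z) w' (τ z))
    (h : ∀ j, (Finset.univ.filter (σ · = j)).card = (Finset.univ.filter (τ · = j)).card) :
    σ = τ := by
  have hpos (z : ι) (hne : σ z ≠ τ z) : 0 < c z (σ z) ∧ 0 < c z (τ z) :=
    ⟨(hc z _).lt_of_ne' fun h0 => hne ((hσ z).eq_of_cost_eq_zero (hc z) hw' (hτ z) h0),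
      (hc z _).lt_of_ne' fun h0 => hne ((hτ z).eq_of_cost_eq_zero (hc z) hw (hσ z) h0).symm⟩
  have h₁ (z : ι) : Real.log (c z (σ z)) - Real.log (w (σ z)) ≤
      Real.log (c z (τ z)) - Real.log (w (τ z)) := by
    by_cases hne : σ z = τ z
    · rw [hne]
    · exact (hσ z).log_sub_le hw (hpos z hne).1 (hpos z hne).2
  have h₂ (z : ι) : Real.log (c z (τ z)) - Real.log (w' (τ z)) ≤
      Real.log (c z (σ z)) - Real.log (w' (σ z)) := by
    by_cases hne : σ z = τ z
    · rw [hne]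
    · exact (hτ z).log_sub_le hw' (hpos z hne).2 (hpos z hne).1
  have s₁ := Finset.sum_le_sum fun z (_ : z ∈ Finset.univ) => h₁ z
  have s₂ := Finset.sum_le_sum fun z (_ : z ∈ Finset.univ) => h₂ z
  have e₁ := sum_comp_eq_of_card_fiber_eq h fun k => Real.log (w k)
  have e₂ := sum_comp_eq_of_card_fiber_eq h fun k => Real.log (w' k)
  have t₁ := (Finset.sum_eq_sum_iff_of_le fun z _ => h₁ z).1
    (le_antisymm s₁ (by simp only [Finset.sum_sub_distrib] at s₂ ⊢; linarith))
  have t₂ := (Finset.sum_eq_sum_iff_of_le fun z _ => h₂ z).1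
    (le_antisymm s₂ (by simp only [Finset.sum_sub_distrib] at s₁ ⊢; linarith))
  funext z
  by_contra hne
  obtain ⟨hσ0, hτ0⟩ := hpos z hne
  exact hne (le_antisymm ((hσ z).le_of_log_sub_eq hw hσ0 hτ0 (t₁ z (Finset.mem_univ z)))
    ((hτ z).le_of_log_sub_eq hw' hτ0 hσ0 (t₂ z (Finset.mem_univ z))))


/-- Growth-function bound for the class of WNN classifiers with fixed labeled centers
`x₁,…,x_m` and varying positive weights: the number of distinct restrictions to a
finite set `Z` of cardinality `N` of the classifiers `h_w` (which label `z` by `y_j`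
for `j` minimizing `dist z (x j) / w j`, ties broken toward the smallest index) is at
most `m! · (N + m)^m`. -/
theorem stmt18 {X : Type*} [MetricSpace X] (m : ℕ) (hm : 0 < m)
    (x : Fin m → X) (y : Fin m → Bool) (Z : Finset X) (N : ℕ) (hZ : Z.card = N) :
    Set.ncard {f : {z // z ∈ Z} → Bool |
        ∃ w : Fin m → ℝ, (∀ j, 0 < w j) ∧
          ∀ z : {z // z ∈ Z}, ∃ j : Fin m, f z = y j ∧
            (∀ k, dist (z : X) (x j) / w j ≤ dist (z : X) (x k) / w k) ∧
            (∀ k, dist (z : X) (x k) / w k = dist (z : X) (x j) / w j → j ≤ k)} ≤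
      Nat.factorial m * (N + m) ^ m := by
  classical
  set S := {f : {z // z ∈ Z} → Bool | _}
  have hex : ∀ f : S, ∃ (w : Fin m → ℝ) (σ : {z // z ∈ Z} → Fin m), (∀ j, 0 < w j) ∧
      (∀ z, f.1 z = y (σ z)) ∧
      ∀ z : {z // z ∈ Z}, IsLeastMinimizer (fun k => dist (z : X) (x k)) w (σ z) := by
    rintro ⟨f, w, hw, hf⟩
    obtain ⟨σ, hσ⟩ := Classical.skolem.1 hf
    exact ⟨w, σ, hw, fun z => (hσ z).1, fun z => (hσ z).2⟩
  choose w σ hw hy hσ using hex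
  let count (f : S) (j : Fin m) : Fin (N + 1) :=
    ⟨(Finset.univ.filter (σ f · = j)).card, Nat.lt_succ_of_le <|
      (Finset.card_le_univ _).trans_eq (by rw [Fintype.card_coe, hZ])⟩
  have hcount : Function.Injective count := fun f g hfg => by
    have hστ : σ f = σ g := eq_of_card_fiber_eq (fun _ _ => dist_nonneg) (hw f) (hw g)
      (hσ f) (hσ g) fun j => congrArg Fin.val (congrFun hfg j)
    exact Subtype.ext (funext fun z => by rw [hy f, hy g, hστ])
  calc S.ncard = Nat.card S := rfl
    _ ≤ Nat.card (Fin m → Fin (N + 1)) := Nat.card_le_card_of_injective count hcount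
    _ = (N + 1) ^ m := by simp
    _ ≤ (N + m) ^ m := Nat.pow_le_pow_left (by lia) m
    _ ≤ m.factorial * (N + m) ^ m := Nat.le_mul_of_pos_left _ m.factorial_pos
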